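/- arXiv:2305.03086 — 5 statements merged into one kernel-verified Lean document; each statement's English description precedes it below -/
import Mathlib

section
/- Let κ, η, μ, a, b, ρ be complex numbers and set φ₀ = (η−μκ)e^{iη(b−a)}[(η+μκ)e^{iκa} − (η−μκ)e^{−iκa}] + (η+μκ)e^{iη(a−b)}[(η+μκ)e^{−iκa} − (η−μκ)e^{iκa}], and assume φ₀ ≠ 0. Define a₀ = (2μρ/(iφ₀))e^{−iηa}(μκ cos(κa) + iη sin(κa)), b₀ = −(2μρ/(iφ₀))e^{iηa}(μκ cos(κa) − iη sin(κa)), c₀ = 2ημρ/(iφ₀), d₀ = −2ημρ/(iφ₀). Then the vector (a₀, b₀, c₀, d₀) solves the linear system M·(a₀,b₀,c₀,d₀)ᵀ = (μρ, 0, 0, 0)ᵀ, where M = [[i(η−μκ)e^{iηb}, −i(η+μκ)e^{−iηb}, 0, 0], [e^{iηa}, e^{−iηa}, −e^{iκa}, −e^{−iκa}], [iηe^{iηa}, −iηe^{−iηa}, −iμκe^{iκa}, iμκe^{−iκa}], [0, 0, 1, 1]]. -/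
open Complex Matrix

/-- The explicit zeroth-order coefficients (a₀, b₀, c₀, d₀) solve the
linear system M·(a₀,b₀,c₀,d₀)ᵀ = (μρ, 0, 0, 0)ᵀ. -/
theorem zeroth_order_solves_system (κ η μ a b ρ : ℂ)
    (φ₀ : ℂ)
    (hφ₀def : φ₀ =
      (η - μ * κ) * exp (I * η * (b - a)) *
        ((η + μ * κ) * exp (I * κ * a) - (η - μ * κ) * exp (-I * κ * a))
      + (η + μ * κ) * exp (I * η * (a - b)) *
        ((η + μ * κ) * exp (-I * κ * a) - (η - μ * κ) * exp (I * κ * a)))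
    (hφ₀ : φ₀ ≠ 0)
    (a₀ b₀ c₀ d₀ : ℂ)
    (ha₀ : a₀ = (2 * μ * ρ / (I * φ₀)) * exp (-I * η * a) *
      (μ * κ * cos (κ * a) + I * η * sin (κ * a)))
    (hb₀ : b₀ = -(2 * μ * ρ / (I * φ₀)) * exp (I * η * a) *
      (μ * κ * cos (κ * a) - I * η * sin (κ * a)))
    (hc₀ : c₀ = 2 * η * μ * ρ / (I * φ₀))
    (hd₀ : d₀ = -(2 * η * μ * ρ / (I * φ₀))) :
    (!![I * (η - μ * κ) * exp (I * η * b), -I * (η + μ * κ) * exp (-I * η * b), 0, 0;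
        exp (I * η * a), exp (-I * η * a), -exp (I * κ * a), -exp (-I * κ * a);
        I * η * exp (I * η * a), -(I * η) * exp (-I * η * a),
          -(I * μ * κ) * exp (I * κ * a), I * μ * κ * exp (-I * κ * a);
        0, 0, 1, 1] : Matrix (Fin 4) (Fin 4) ℂ).mulVec ![a₀, b₀, c₀, d₀]
      = ![μ * ρ, 0, 0, 0] := by
  have hcos : cos (κ * a) = (exp (I * κ * a) + exp (-I * κ * a)) / 2 := by
    rw [Complex.cos]
    ring_nf
  have hsin : I * sin (κ * a) = (exp (I * κ * a) - exp (-I * κ * a)) / 2 := by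
    rw [Complex.sin]
    ring_nf
    rw [I_sq]
    ring
  have hba : exp (I * η * (b - a)) = exp (I * η * b) * exp (-I * η * a) := by
    rw [← exp_add]
    ring_nf
  have hab : exp (I * η * (a - b)) = exp (-I * η * b) * exp (I * η * a) := by
    rw [← exp_add]
    ring_nf
  have hmul : exp (I * η * a) * exp (-I * η * a) = 1 := by
    rw [← exp_add]
    ring_nf
    exact exp_zero
  rw [mul_right_comm I η (sin _), hsin, hcos] at ha₀ hb₀
  rw [hba, hab] at hφ₀def
  have hr : μ * ρ = μ * ρ / (I * φ₀) * (I * φ₀) :=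
    (div_mul_cancel₀ _ (mul_ne_zero I_ne_zero hφ₀)).symm
  have h2 : 2 * μ * ρ / (I * φ₀) = 2 * (μ * ρ / (I * φ₀)) := by ring
  have h3 : 2 * η * μ * ρ / (I * φ₀) = 2 * η * (μ * ρ / (I * φ₀)) := by ring
  rw [h2] at ha₀ hb₀
  rw [h3] at hc₀ hd₀
  generalize μ * ρ / (I * φ₀) = t at *
  generalize exp (I * η * a) = x at *
  generalize exp (-I * η * a) = x' at *
  generalize exp (I * κ * a) = E at *
  generalize exp (-I * κ * a) = e at *
  ext i
  fin_cases i <;> simp [Matrix.mulVec, dotProduct, Fin.sum_univ_four]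
  · rw [hr, ha₀, hb₀, hφ₀def]
    ring_nf
  · rw [ha₀, hb₀, hc₀, hd₀]
    linear_combination 2 * t * η * (E - e) * hmul
  · rw [ha₀, hb₀, hc₀, hd₀]
    linear_combination 2 * t * I * η * μ * κ * (E + e) * hmul
  · rw [hc₀, hd₀]
    ring
end

section
/- Let κ, η, μ, ρ be complex numbers and a, b real numbers with 0 < a < b. Set φ₀ = (η−μκ)e^{iη(b−a)}[(η+μκ)e^{iκa} − (η−μκ)e^{−iκa}] + (η+μκ)e^{iη(a−b)}[(η+μκ)e^{−iκa} − (η−μκ)e^{iκa}] and assume φ₀ ≠ 0. Define a₀ = (2μρ/(iφ₀))e^{−iηa}(μκ cos(κa) + iη sin(κa)) and b₀ = −(2μρ/(iφ₀))e^{iηa}(μκ cos(κa) − iη sin(κa)), and define U : ℝ → ℂ by U(y) = (4ημρ/φ₀) sin(κy) for y ≤ a and U(y) = a₀e^{iηy} + b₀e^{−iηy} for y > a. Then: (1) U''(y) + κ²U(y) = 0 for 0 < y < a; (2) U''(y) + η²U(y) = 0 for a < y < b; (3) U(0) = 0; (4) U is continuous at y = a, i.e. (4ημρ/φ₀) sin(κa)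 = a₀e^{iηa} + b₀e^{−iηa}; (5) the one-sided derivatives at a satisfy iη(a₀e^{iηa} − b₀e^{−iηa}) = μ·(4ημρκ/φ₀) cos(κa); and (6) at y = b, U'(b) = μ(iκ·U(b) + ρ). -/
open Complex

lemma hasDerivAt_planeWaves (A B k : ℂ) (y : ℝ) :
    HasDerivAt (fun t : ℝ => A * exp (I * k * t) + B * exp (-I * k * t))
      (I * k * A * exp (I * k * y) + -(I * k * B) * exp (-I * k * y)) y := by
  have h (c : ℂ) : HasDerivAt (fun t : ℝ => exp (c * t)) (exp (c * y) * (c * 1)) y :=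
    (ofRealCLM.hasDerivAt.const_mul c).cexp
  refine (((h (I * k)).const_mul A).add ((h (-I * k)).const_mul B)).congr_deriv ?_
  ring

lemma deriv_deriv_planeWaves (A B k : ℂ) (y : ℝ) :
    deriv (deriv fun t : ℝ => A * exp (I * k * t) + B * exp (-I * k * t)) y
      = -k ^ 2 * (A * exp (I * k * y) + B * exp (-I * k * y)) := by
  rw [funext fun t => (hasDerivAt_planeWaves A B k t).deriv,
    (hasDerivAt_planeWaves _ _ k y).deriv]
  linear_combination (k ^ 2 * (A * exp (I * k * y) + B * exp (-I * k * y))) * I_sq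

lemma const_mul_sin_eq_planeWaves (A k : ℂ) (y : ℝ) :
    A * sin (k * y) = -(A * I / 2) * exp (I * k * y) + (A * I / 2) * exp (-I * k * y) := by
  rw [Complex.sin, show k * y * I = I * k * y by ring, show -(k * y) * I = -I * k * y by ring]
  ring

/-- The piecewise zeroth-order field U satisfies the Helmholtz equations
below and inside the slab, the PEC condition at 0, continuity and the jump condition
of the derivative at a, and the transparent boundary condition at b. -/
theorem zeroth_order_field_properties (κ η μ ρ : ℂ) (a b : ℝ)
    (ha : 0 < a) (hab : a < b)
    (φ₀ : ℂ)
    (hφ₀def : φ₀ =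
      (η - μ * κ) * exp (I * η * ((b : ℂ) - (a : ℂ))) *
        ((η + μ * κ) * exp (I * κ * a) - (η - μ * κ) * exp (-I * κ * a))
      + (η + μ * κ) * exp (I * η * ((a : ℂ) - (b : ℂ))) *
        ((η + μ * κ) * exp (-I * κ * a) - (η - μ * κ) * exp (I * κ * a)))
    (hφ₀ : φ₀ ≠ 0)
    (a₀ b₀ : ℂ)
    (ha₀ : a₀ = (2 * μ * ρ / (I * φ₀)) * exp (-I * η * a) *
      (μ * κ * cos (κ * a) + I * η * sin (κ * a)))
    (hb₀ : b₀ = -(2 * μ * ρ / (I * φ₀)) * exp (I * η * a) *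
      (μ * κ * cos (κ * a) - I * η * sin (κ * a)))
    (U : ℝ → ℂ)
    (hU : ∀ y : ℝ, U y =
      if y ≤ a then (4 * η * μ * ρ / φ₀) * sin (κ * y)
      else a₀ * exp (I * η * y) + b₀ * exp (-I * η * y)) :
    (∀ y ∈ Set.Ioo (0 : ℝ) a, deriv (deriv U) y + κ ^ 2 * U y = 0) ∧
    (∀ y ∈ Set.Ioo a b, deriv (deriv U) y + η ^ 2 * U y = 0) ∧
    U 0 = 0 ∧
    (4 * η * μ * ρ / φ₀) * sin (κ * a) = a₀ * exp (I * η * a) + b₀ * exp (-I * η * a) ∧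
    I * η * (a₀ * exp (I * η * a) - b₀ * exp (-I * η * a))
      = μ * (4 * η * μ * ρ * κ / φ₀) * cos (κ * a) ∧
    deriv U b = μ * (I * κ * U b + ρ) := by
  have hbelow {y : ℝ} (hy : y < a) :
      U =ᶠ[nhds y] fun t : ℝ => -(4 * η * μ * ρ / φ₀ * I / 2) * exp (I * κ * t)
        + (4 * η * μ * ρ / φ₀ * I / 2) * exp (-I * κ * t) := by
    filter_upwards [Iio_mem_nhds hy] with t ht
    rw [hU, if_pos (le_of_lt ht), const_mul_sin_eq_planeWaves]
  have habove {y : ℝ} (hy : a < y) :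
      U =ᶠ[nhds y] fun t : ℝ => a₀ * exp (I * η * t) + b₀ * exp (-I * η * t) := by
    filter_upwards [Ioi_mem_nhds hy] with t ht
    rw [hU, if_neg (not_le.mpr ht)]
  have hcancel : exp (I * η * a) * exp (-I * η * a) = 1 := by
    rw [← Complex.exp_add, ← Complex.exp_zero]
    ring_nf
  have hup : a₀ * exp (I * η * a)
      = -(2 * I * μ * ρ / φ₀) * (μ * κ * cos (κ * a) + I * η * sin (κ * a)) := by
    rw [ha₀, div_mul_eq_div_div, div_I]
    linear_combination
      (-(2 * I * μ * ρ / φ₀) * (μ * κ * cos (κ * a) + I * η * sin (κ * a))) * hcancel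
  have hdown : b₀ * exp (-I * η * a)
      = (2 * I * μ * ρ / φ₀) * (μ * κ * cos (κ * a) - I * η * sin (κ * a)) := by
    rw [hb₀, div_mul_eq_div_div, div_I]
    linear_combination
      ((2 * I * μ * ρ / φ₀) * (μ * κ * cos (κ * a) - I * η * sin (κ * a))) * hcancel
  refine ⟨fun y hy => ?_, fun y hy => ?_, ?_, ?_, ?_, ?_⟩
  · rw [(hbelow hy.2).deriv.deriv_eq, deriv_deriv_planeWaves, (hbelow hy.2).eq_of_nhds]
    ring
  · rw [(habove hy.1).deriv.deriv_eq, deriv_deriv_planeWaves, (habove hy.1).eq_of_nhds]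
    ring
  · simp [hU, ha.le]
  · rw [hup, hdown]
    linear_combination (4 * η * μ * ρ / φ₀ * sin (κ * a)) * I_sq
  · rw [hup, hdown]
    linear_combination (-4 * η * μ ^ 2 * ρ * κ / φ₀ * cos (κ * a)) * I_sq
  · have hE : exp (I * η * b) = exp (I * η * a) * exp (I * η * ((b : ℂ) - a)) := by
      rw [← Complex.exp_add]
      ring_nf
    have hF : exp (-I * η * b) = exp (-I * η * a) * exp (I * η * ((a : ℂ) - b)) := by
      rw [← Complex.exp_add]
      ring_nf
    have hp : exp (I * κ * a) = cos (κ * a) + sin (κ * a) * I := by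
      rw [← Complex.exp_mul_I]
      ring_nf
    have hm : exp (-I * κ * a) = cos (κ * a) - sin (κ * a) * I := by
      rw [show -I * κ * a = -(κ * a) * I by ring, Complex.exp_mul_I, Complex.cos_neg,
        Complex.sin_neg]
      ring
    rw [hp, hm] at hφ₀def
    have hρ : μ * ρ = μ * ρ / φ₀ * φ₀ := (div_mul_cancel₀ _ hφ₀).symm
    rw [(habove hab).deriv_eq, (hasDerivAt_planeWaves a₀ b₀ η b).deriv,
      (habove hab).eq_of_nhds, hE, hF]
    generalize exp (I * η * ((b : ℂ) - a)) = E at *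
    generalize exp (I * η * ((a : ℂ) - b)) = F at *
    linear_combination I * (η - μ * κ) * E * hup - I * (η + μ * κ) * F * hdown - hρ
      - μ * ρ / φ₀ * hφ₀def
      + (-(2 * μ * ρ / φ₀) * ((η - μ * κ) * E * (μ * κ * cos (κ * a) + I * η * sin (κ * a))
        + (η + μ * κ) * F * (μ * κ * cos (κ * a) - I * η * sin (κ * a)))) * I_sq
end

section
/- Let α, β, κ be complex numbers satisfying κ² = α² + β², and let a be a real number. Then ∫₀^a sin(βy)·(2κ sin(κy) − α²(a−y)cos(κy)) dy = aβ − sin(βa)·cos(κa). -/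
open Complex

/-- the key integral identity used to evaluate the first-order source
functional ψₙ, under the dispersion relation κ² = α² + β². -/
theorem key_integral_identity (α β κ : ℂ) (hdisp : κ ^ 2 = α ^ 2 + β ^ 2) (a : ℝ) :
    (∫ y in (0 : ℝ)..a,
        sin (β * y) * (2 * κ * sin (κ * y) - α ^ 2 * ((a : ℂ) - y) * cos (κ * y)))
      = (a : ℂ) * β - sin (β * a) * cos (κ * a) := by
  have hsin (c : ℂ) (y : ℝ) : HasDerivAt (fun y : ℝ => sin (c * y)) (c * cos (c * y)) y := by
    simpa [mul_comm] using ((hasDerivAt_id (y : ℂ)).const_mul c).csin.comp_ofReal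
  have hcos (c : ℂ) (y : ℝ) : HasDerivAt (fun y : ℝ => cos (c * y)) (-(c * sin (c * y))) y := by
    simpa [mul_comm] using ((hasDerivAt_id (y : ℂ)).const_mul c).ccos.comp_ofReal
  have hlin (y : ℝ) : HasDerivAt (fun y : ℝ => (y : ℂ) - a) 1 y := by
    simpa using ((hasDerivAt_id (y : ℂ)).sub_const (a : ℂ)).comp_ofReal
  have hderiv (y : ℝ) : HasDerivAt
      (fun y : ℝ => ((y : ℂ) - a) *
          (κ * (sin (β * y) * sin (κ * y)) + β * (cos (β * y) * cos (κ * y)))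
        - sin (β * y) * cos (κ * y))
      (sin (β * y) * (2 * κ * sin (κ * y) - α ^ 2 * ((a : ℂ) - y) * cos (κ * y))) y := by
    refine HasDerivAt.congr_deriv (((hlin y).mul ((((hsin β y).mul (hsin κ y)).const_mul κ).add
      (((hcos β y).mul (hcos κ y)).const_mul β))).sub ((hsin β y).mul (hcos κ y))) ?_
    simp only [Pi.add_apply, Pi.mul_apply]
    linear_combination sin (β * y) * ((y : ℂ) - a) * cos (κ * y) * hdisp
  rw [intervalIntegral.integral_eq_sub_of_hasDerivAt (fun y _ => hderiv y)
    (Continuous.intervalIntegrable (by fun_prop) _ _)]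
  simp
  ring
end

section
/- Let κ, η, μ, ρ, αₙ, βₙ, g⁽ⁿ⁾, φ₀ be complex numbers with φ₀ ≠ 0, let a > 0 be real, and assume κ² = αₙ² + βₙ². Define v(y) = (4κημρ/(aφ₀))·(2κ sin(κy) − αₙ²(a−y)cos(κy))·g⁽ⁿ⁾ for y ∈ [0,a] and τ = (4κημ²ρ/(aφ₀))·cos(κa)·g⁽ⁿ⁾. Then μ∫₀^a sin(βₙy)·v(y) dy + sin(βₙa)·τ = (4κημ²ρβₙ/φ₀)·g⁽ⁿ⁾. -/
open Complex

lemma hasDerivAt_sin_mul_ofReal (k : ℂ) (y : ℝ) :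
    HasDerivAt (fun t : ℝ => sin (k * t)) (k * cos (k * y)) y := by
  have h : HasDerivAt (fun z : ℂ => k * z) k (y : ℂ) := by
    simpa using (hasDerivAt_id (y : ℂ)).const_mul k
  simpa [mul_comm] using h.csin.comp_ofReal

lemma hasDerivAt_cos_mul_ofReal (k : ℂ) (y : ℝ) :
    HasDerivAt (fun t : ℝ => cos (k * t)) (-(k * sin (k * y))) y := by
  have h : HasDerivAt (fun z : ℂ => k * z) k (y : ℂ) := by
    simpa using (hasDerivAt_id (y : ℂ)).const_mul k
  simpa [mul_comm] using h.ccos.comp_ofReal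

lemma integral_sin_mul_source (κ β : ℂ) (a : ℝ) :
    ∫ y in (0 : ℝ)..a, sin (β * y) *
        (2 * κ * sin (κ * y) - (κ ^ 2 - β ^ 2) * ((a : ℂ) - y) * cos (κ * y))
      = a * β - sin (β * a) * cos (κ * a) := by
  have hderiv : ∀ y ∈ Set.uIcc 0 a, HasDerivAt
      (fun t : ℝ => ((t : ℂ) - a) *
          (κ * (sin (β * t) * sin (κ * t)) + β * (cos (β * t) * cos (κ * t)))
        - sin (β * t) * cos (κ * t))
      (sin (β * y) *
        (2 * κ * sin (κ * y) - (κ ^ 2 - β ^ 2) * ((a : ℂ) - y) * cos (κ * y))) y := by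
    intro y _
    have hs := hasDerivAt_sin_mul_ofReal β y
    have hc := hasDerivAt_cos_mul_ofReal β y
    have hS := hasDerivAt_sin_mul_ofReal κ y
    have hC := hasDerivAt_cos_mul_ofReal κ y
    have hy : HasDerivAt (fun t : ℝ => (t : ℂ) - a) 1 y :=
      ((hasDerivAt_id (y : ℂ)).comp_ofReal).sub_const _
    refine ((hy.mul (((hs.mul hS).const_mul κ).add ((hc.mul hC).const_mul β))).sub
      (hs.mul hC)).congr_deriv ?_
    simp only [Pi.add_apply, Pi.mul_apply]
    ring
  rw [intervalIntegral.integral_eq_sub_of_hasDerivAt hderiv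
    (Continuous.intervalIntegrable (by fun_prop) _ _)]
  simp
  ring

/-- evaluation of the first-order source functional
ψₙ = μ∫₀^a sin(βₙy)v(y)dy + sin(βₙa)τ = 4κημ²ρβₙg⁽ⁿ⁾/φ₀. -/
theorem psi_evaluation (κ η μ ρ αn βn gn φ₀ : ℂ) (hφ₀ : φ₀ ≠ 0)
    (a : ℝ) (ha : 0 < a) (hdisp : κ ^ 2 = αn ^ 2 + βn ^ 2)
    (v : ℝ → ℂ) (τ : ℂ)
    (hv : ∀ y : ℝ, v y = (4 * κ * η * μ * ρ / ((a : ℂ) * φ₀)) *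
      (2 * κ * sin (κ * y) - αn ^ 2 * ((a : ℂ) - y) * cos (κ * y)) * gn)
    (hτ : τ = (4 * κ * η * μ ^ 2 * ρ / ((a : ℂ) * φ₀)) * cos (κ * a) * gn) :
    μ * (∫ y in (0 : ℝ)..a, sin (βn * y) * v y) + sin (βn * a) * τ
      = (4 * κ * η * μ ^ 2 * ρ * βn / φ₀) * gn := by
  have hα : αn ^ 2 = κ ^ 2 - βn ^ 2 := by rw [hdisp]; ring
  have ha' : (a : ℂ) ≠ 0 := by exact_mod_cast ha.ne'
  have hint : ∫ y in (0 : ℝ)..a, sin (βn * y) * v y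
      = (4 * κ * η * μ * ρ / ((a : ℂ) * φ₀) * gn) *
        (a * βn - sin (βn * a) * cos (κ * a)) := by
    rw [← integral_sin_mul_source, ← intervalIntegral.integral_const_mul]
    congr 1
    funext y
    rw [hv, hα]
    ring
  rw [hint, hτ]
  field_simp
  ring
end

section
/- Let γ, β, μ, s, t be complex numbers and a, b real numbers, with μβ ≠ 0. Set φ = (γ−μβ)e^{iγ(b−a)}[(γ+μβ)e^{iβa} − (γ−μβ)e^{−iβa}] + (γ+μβ)e^{iγ(a−b)}[(γ+μβ)e^{−iβa} − (γ−μβ)e^{iβa}] and assume φ ≠ 0. Define A = (2(γ+μβ)/φ)·e^{−iγb}·(μβ cos(βa)·s − sin(βa)·t) and B = (2(γ−μβ)/φ)·e^{iγb}·(μβ cos(βa)·s − sin(βa)·t). Then there exist complex numbers C, D such that M·(A, B, C, D)ᵀ = (0, s, t, 0)ᵀ, where M = [[i(γ−μβ)e^{iγb}, −i(γ+μβ)e^{−iγb}, 0, 0], [e^{iγa}, e^{−iγa}, −e^{iβa}, −e^{−iβa}], [iγe^{iγa}, −iγe^{−iγa}, −iμβe^{iβa}, iμβe^{−iβa}], [0,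 0, 1, 1]]. -/
open Complex Matrix

/-- The equations `c * (x - y) = X` and `c * (n * (x + y)) = Y` in the unknown `c`, where `y` is the
inverse of `x`, have a common solution as soon as they are compatible. -/
lemma exists_mul_sub_eq_mul_add_eq {K : Type*} [Field K] [NeZero (2 : K)] {x y n X Y : K}
    (hxy : x * y = 1) (hn : n ≠ 0) (h : X * (n * (x + y)) = Y * (x - y)) :
    ∃ c : K, c * (x - y) = X ∧ c * (n * (x + y)) = Y := by
  have h2 : (2 : K) ≠ 0 := NeZero.ne 2
  refine ⟨y / 2 * (X + Y / n), ?_, ?_⟩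
  · field_simp
    linear_combination (-y) * h + 2 * n * X * hxy
  · field_simp
    linear_combination y * h + 2 * Y * hxy

/-- the Cramer's-rule formulas A, B for the slab coefficients of the
first-order system extend (by suitable C, D) to a solution of the full linear system
with right-hand side (0, s, t, 0). -/
theorem first_order_cramer (γ β μ s t : ℂ) (a b : ℝ) (hμβ : μ * β ≠ 0)
    (φ : ℂ)
    (hφdef : φ =
      (γ - μ * β) * exp (I * γ * ((b : ℂ) - (a : ℂ))) *
        ((γ + μ * β) * exp (I * β * a) - (γ - μ * β) * exp (-I * β * a))
      + (γ + μ * β) * exp (I * γ * ((a : ℂ) - (b : ℂ))) *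
        ((γ + μ * β) * exp (-I * β * a) - (γ - μ * β) * exp (I * β * a)))
    (hφ : φ ≠ 0)
    (A B : ℂ)
    (hA : A = (2 * (γ + μ * β) / φ) * exp (-I * γ * b) *
      (μ * β * cos (β * a) * s - sin (β * a) * t))
    (hB : B = (2 * (γ - μ * β) / φ) * exp (I * γ * b) *
      (μ * β * cos (β * a) * s - sin (β * a) * t)) :
    ∃ C D : ℂ,
      (!![I * (γ - μ * β) * exp (I * γ * b), -I * (γ + μ * β) * exp (-I * γ * b), 0, 0;
          exp (I * γ * a), exp (-I * γ * a), -exp (I * β * a), -exp (-I * β * a);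
          I * γ * exp (I * γ * a), -(I * γ) * exp (-I * γ * a),
            -(I * μ * β) * exp (I * β * a), I * μ * β * exp (-I * β * a);
          0, 0, 1, 1] : Matrix (Fin 4) (Fin 4) ℂ).mulVec ![A, B, C, D]
        = ![0, s, t, 0] := by
  have hx : exp (I * β * a) * exp (-I * β * a) = 1 := by
    rw [← exp_add]; simp
  have hba : exp (I * γ * ((b : ℂ) - a)) = exp (I * γ * b) * exp (-I * γ * a) := by
    rw [← exp_add]; ring_nf
  have hab : exp (I * γ * ((a : ℂ) - b)) = exp (I * γ * a) * exp (-I * γ * b) := by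
    rw [← exp_add]; ring_nf
  have hcos : cos (β * a) = (exp (I * β * a) + exp (-I * β * a)) / 2 := by
    rw [Complex.cos]; ring_nf
  have hsin : sin (β * a) = (exp (-I * β * a) - exp (I * β * a)) * I / 2 := by
    rw [Complex.sin]; ring_nf
  rw [hba, hab] at hφdef
  rw [hcos, hsin] at hA hB
  generalize exp (I * β * a) = x at *
  generalize exp (-I * β * a) = y at *
  generalize exp (I * γ * a) = p at *
  generalize exp (-I * γ * a) = p' at *
  generalize exp (I * γ * b) = q at *
  generalize exp (-I * γ * b) = q' at *
  have hn : I * (μ * β) ≠ 0 := mul_ne_zero I_ne_zero hμβ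
  have hcompat : (p * A + p' * B - s) * (I * (μ * β) * (x + y)) =
      (I * γ * (p * A - p' * B) - t) * (x - y) := by
    obtain ⟨R, hR⟩ : ∃ R, R = (μ * β * ((x + y) / 2) * s - (y - x) * I / 2 * t) / φ := ⟨_, rfl⟩
    have hRφ : R * φ = μ * β * ((x + y) / 2) * s - (y - x) * I / 2 * t := by
      rw [hR, div_mul_cancel₀ _ hφ]
    have hA' : A = 2 * (γ + μ * β) * q' * R := by rw [hA, hR]; ring
    have hB' : B = 2 * (γ - μ * β) * q * R := by rw [hB, hR]; ring
    rw [hφdef] at hRφ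
    rw [hA', hB']
    linear_combination 2 * I * hRφ + (x - y) * t * I_sq
  obtain ⟨C, hC₁, hC₂⟩ := exists_mul_sub_eq_mul_add_eq hx hn hcompat
  refine ⟨C, -C, ?_⟩
  have hrow : (γ - μ * β) * q * A = (γ + μ * β) * q' * B := by
    rw [hA, hB]; ring
  ext i
  fin_cases i <;> simp [Matrix.mulVec, dotProduct, Fin.sum_univ_four]
  · linear_combination I * hrow
  · linear_combination -hC₁
  · linear_combination -hC₂
end
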